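/- arXiv:0808.1401 — 7 statements merged into one kernel-verified Lean document; each statement's English description precedes it below -/
import Mathlib

section
/- Bäcklund transformation s_0: Suppose α0,α1,α2,α3,α4 ∈ ℂ satisfy α0+2α1+3α2+2α3+α4 = 1, and (x(t),y(t),z(t),w(t)) is a differentiable solution of the coupled Painlevé VI system dx/dt = ∂H/∂y, dy/dt = −∂H/∂x, dz/dt = ∂H/∂w, dw/dt = −∂H/∂z on an interval/domain avoiding t ∈ {0,1}, with y(t) ≠ 0 throughout. Then (x + α0/y, y, z, w) is a solution of the same system with parameters (−α0, α1+α0, α2, α3, α4). -/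
noncomputable section

/-- The polynomial Hamiltonian `H` of the coupled Painlevé VI system of type `E₆⁽²⁾`,
defined by `t(1-t)H = ...`. -/
def H (a0 a1 a2 a3 a4 t x y z w : ℂ) : ℂ :=
  (t * (1 - t))⁻¹ *
    (x ^ 2 * y ^ 3 + ((1 - 2 * t) * x - 2 * a1 - a2 - a3) * x * y ^ 2
      + ((t - 1) * t * x ^ 2
          + ((4 * a1 + 4 * a2 + 3 * a3 + a4) * t - (2 * a1 + 2 * a2 + 2 * a3 + a4)) * x
          + a1 * (a1 + a2 + a3)) * y
      - (1 - t) * t * a0 * x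
      + (1 / 4) * (-(z ^ 2 * w ^ 4) + 2 * a3 * z * w ^ 3
          + ((1 + t) * z ^ 2 + 2 * (2 * a1 + 2 * a2 + a3) * z - a3 ^ 2) * w ^ 2
          - 2 * (((-(2 * a1) - 2 * a2 - a3 - a4) * t + (2 * a1 + 2 * a2 + 2 * a3 + a4)) * z
              + a3 * (2 * a1 + 2 * a2 + a3)) * w
          - t * (z + 4 * a1 + 4 * a2 + 2 * a3) * z)
      + (t * x * z + (1 - t) * x * z * w - x * z * w ^ 2 - x * y * z + x * y * z * w
          - a1 * (w - 1) * z + a3 * x * w) * y)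

/-- Partial derivative `∂H/∂x`. -/
def Hx (a0 a1 a2 a3 a4 t x y z w : ℂ) : ℂ :=
  deriv (fun s => H a0 a1 a2 a3 a4 t s y z w) x

/-- Partial derivative `∂H/∂y`. -/
def Hy (a0 a1 a2 a3 a4 t x y z w : ℂ) : ℂ :=
  deriv (fun s => H a0 a1 a2 a3 a4 t x s z w) y

/-- Partial derivative `∂H/∂z`. -/
def Hz (a0 a1 a2 a3 a4 t x y z w : ℂ) : ℂ :=
  deriv (fun s => H a0 a1 a2 a3 a4 t x y s w) z

/-- Partial derivative `∂H/∂w`. -/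
def Hw (a0 a1 a2 a3 a4 t x y z w : ℂ) : ℂ :=
  deriv (fun s => H a0 a1 a2 a3 a4 t x y z s) w

end

/-- Chain rule for a function of two variables along the graph of `f`, in terms of
partial derivatives. -/
theorem hasDerivAt_comp_graph {F : ℂ → ℂ → ℂ} {f : ℂ → ℂ} {f' y : ℂ}
    (hF : DifferentiableAt ℂ (fun p : ℂ × ℂ => F p.1 p.2) (f y, y)) (hf : HasDerivAt f f' y) :
    HasDerivAt (fun s => F (f s) s)
      (f' * deriv (fun s => F s y) (f y) + deriv (fun s => F (f y) s) y) y := by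
  obtain ⟨L, hL⟩ := hF
  have h₁ : HasDerivAt (fun s => F s y) (L (1, 0)) (f y) :=
    HasFDerivAt.comp_hasDerivAt (f := fun s => (s, y)) (f y) hL
      ((hasDerivAt_id (f y)).prodMk (hasDerivAt_const (f y) y))
  have h₂ : HasDerivAt (fun s => F (f y) s) (L (0, 1)) y :=
    HasFDerivAt.comp_hasDerivAt (f := fun s => (f y, s)) y hL
      ((hasDerivAt_const y (f y)).prodMk (hasDerivAt_id y))
  have h₃ : HasDerivAt (fun s => F (f s) s) (L (f', 1)) y :=
    HasFDerivAt.comp_hasDerivAt (f := fun s => (f s, s)) y hL (hf.prodMk (hasDerivAt_id y))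
  rw [h₁.deriv, h₂.deriv]
  convert h₃ using 1
  rw [← smul_eq_mul, ← map_smul, ← map_add]
  simp

/-- The Hamiltonian is invariant under `s₀` up to a function of `t` alone. -/
theorem H_s0 (a0 a1 a2 a3 a4 t x y z w : ℂ) (hy : y ≠ 0) :
    H (-a0) (a1 + a0) a2 a3 a4 t (x + a0 / y) y z w =
      H a0 a1 a2 a3 a4 t x y z w + (t * (1 - t))⁻¹ * (a0 * ((1 - 2 * t) * a0
        + ((4 * a1 + 4 * a0 + 4 * a2 + 3 * a3 + a4) * t
          - (2 * a1 + 2 * a0 + 2 * a2 + 2 * a3 + a4)))) := by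
  rw [H, H, ← mul_add]
  field_simp
  ring

theorem Hx_s0 (a0 a1 a2 a3 a4 t x y z w : ℂ) (hy : y ≠ 0) :
    Hx (-a0) (a1 + a0) a2 a3 a4 t (x + a0 / y) y z w = Hx a0 a1 a2 a3 a4 t x y z w := by
  rw [Hx, Hx, ← deriv_comp_add_const]
  simp_rw [H_s0 _ _ _ _ _ _ _ _ _ _ hy, deriv_add_const]

theorem Hz_s0 (a0 a1 a2 a3 a4 t x y z w : ℂ) (hy : y ≠ 0) :
    Hz (-a0) (a1 + a0) a2 a3 a4 t (x + a0 / y) y z w = Hz a0 a1 a2 a3 a4 t x y z w := by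
  simp_rw [Hz, H_s0 _ _ _ _ _ _ _ _ _ _ hy, deriv_add_const]

theorem Hw_s0 (a0 a1 a2 a3 a4 t x y z w : ℂ) (hy : y ≠ 0) :
    Hw (-a0) (a1 + a0) a2 a3 a4 t (x + a0 / y) y z w = Hw a0 a1 a2 a3 a4 t x y z w := by
  simp_rw [Hw, H_s0 _ _ _ _ _ _ _ _ _ _ hy, deriv_add_const]

theorem Hy_s0 (a0 a1 a2 a3 a4 t x y z w : ℂ) (hy : y ≠ 0) :
    Hy (-a0) (a1 + a0) a2 a3 a4 t (x + a0 / y) y z w =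
      a0 / y ^ 2 * Hx a0 a1 a2 a3 a4 t x y z w + Hy a0 a1 a2 a3 a4 t x y z w := by
  have hf : HasDerivAt (fun s => x + a0 / y - a0 / s) (a0 / y ^ 2) y := by
    refine (((hasDerivAt_const y a0).div (hasDerivAt_id y) hy).const_sub
      (x + a0 / y)).congr_deriv ?_
    simp [neg_div]
  have hF : DifferentiableAt ℂ (fun p : ℂ × ℂ => H a0 a1 a2 a3 a4 t p.1 p.2 z w)
      (x + a0 / y - a0 / y, y) := by
    unfold H
    fun_prop
  have h := (hasDerivAt_comp_graph (F := fun u v => H a0 a1 a2 a3 a4 t u v z w) hF hf).add_const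
    ((t * (1 - t))⁻¹ * (a0 * ((1 - 2 * t) * a0
      + ((4 * a1 + 4 * a0 + 4 * a2 + 3 * a3 + a4) * t
        - (2 * a1 + 2 * a0 + 2 * a2 + 2 * a3 + a4)))))
  simp only [add_sub_cancel_right] at h
  refine (h.congr_of_eventuallyEq ?_).deriv
  filter_upwards [isOpen_ne.mem_nhds hy] with s hs
  rw [← H_s0 _ _ _ _ _ _ _ _ _ _ hs, sub_add_cancel]

/-- Bäcklund transformation `s₀`: if `(x, y, z, w)` solves the coupled Painlevé VI system with parameters `(α₀, α₁, α₂, α₃, α₄)` on a domain avoiding `t ∈ {0, 1}` with `y ≠ 0`, then `(x + α₀/y, y, z, w)` solves the system with parameters `(-α₀, α₁+α₀, α₂, α₃, α₄)`. -/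
theorem backlund_s0
    (a0 a1 a2 a3 a4 : ℂ) (hparam : a0 + 2 * a1 + 3 * a2 + 2 * a3 + a4 = 1)
    (U : Set ℂ) (hU : ∀ t ∈ U, t ≠ 0 ∧ t ≠ 1)
    (x y z w : ℂ → ℂ)
    (hy0 : ∀ t ∈ U, y t ≠ 0)
    (hx : ∀ t ∈ U, HasDerivAt x (Hy a0 a1 a2 a3 a4 t (x t) (y t) (z t) (w t)) t)
    (hy : ∀ t ∈ U, HasDerivAt y (-Hx a0 a1 a2 a3 a4 t (x t) (y t) (z t) (w t)) t)
    (hz : ∀ t ∈ U, HasDerivAt z (Hw a0 a1 a2 a3 a4 t (x t) (y t) (z t) (w t)) t)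
    (hw : ∀ t ∈ U, HasDerivAt w (-Hz a0 a1 a2 a3 a4 t (x t) (y t) (z t) (w t)) t) :
    (∀ t ∈ U, HasDerivAt (fun s => x s + a0 / y s)
        (Hy (-a0) (a1 + a0) a2 a3 a4 t (x t + a0 / y t) (y t) (z t) (w t)) t) ∧
    (∀ t ∈ U, HasDerivAt y
        (-Hx (-a0) (a1 + a0) a2 a3 a4 t (x t + a0 / y t) (y t) (z t) (w t)) t) ∧
    (∀ t ∈ U, HasDerivAt z
        (Hw (-a0) (a1 + a0) a2 a3 a4 t (x t + a0 / y t) (y t) (z t) (w t)) t) ∧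
    (∀ t ∈ U, HasDerivAt w
        (-Hz (-a0) (a1 + a0) a2 a3 a4 t (x t + a0 / y t) (y t) (z t) (w t)) t) := by
  refine ⟨fun t ht => ?_, fun t ht => ?_, fun t ht => ?_, fun t ht => ?_⟩
  · have hyt := hy0 t ht
    rw [Hy_s0 _ _ _ _ _ _ _ _ _ _ hyt]
    refine ((hx t ht).add ((hasDerivAt_const t a0).div (hy t ht) hyt)).congr_deriv ?_
    ring
  · rw [Hx_s0 _ _ _ _ _ _ _ _ _ _ (hy0 t ht)]
    exact hy t ht
  · rw [Hw_s0 _ _ _ _ _ _ _ _ _ _ (hy0 t ht)]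
    exact hz t ht
  · rw [Hz_s0 _ _ _ _ _ _ _ _ _ _ (hy0 t ht)]
    exact hw t ht
end

section
/- Bäcklund transformation s_2: Suppose α0,α1,α2,α3,α4 ∈ ℂ satisfy α0+2α1+3α2+2α3+α4 = 1, and (x(t),y(t),z(t),w(t)) is a differentiable solution of the coupled Painlevé VI system dx/dt = ∂H/∂y, dy/dt = −∂H/∂x, dz/dt = ∂H/∂w, dw/dt = −∂H/∂z on a domain avoiding t ∈ {0,1}, with y(t) + w(t)² − t ≠ 0 throughout. Then (x + α2/(y+w²−t), y, z + 2α2w/(y+w²−t), w) is a solution of the same system with parameters (α0, α1+α2, −α2, α3+2α2, α4). -/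
/-- The derivative of a quartic polynomial function, up to a constant factor. -/
lemma hasDerivAt_const_mul_quartic (k c0 c1 c2 c3 c4 s : ℂ) :
    HasDerivAt (fun s => k * (c0 + c1 * s + c2 * s ^ 2 + c3 * s ^ 3 + c4 * s ^ 4))
      (k * (c1 + 2 * c2 * s + 3 * c3 * s ^ 2 + 4 * c4 * s ^ 3)) s := by
  have h := (((((hasDerivAt_const s c0).add ((hasDerivAt_id s).const_mul c1)).add
    ((hasDerivAt_pow 2 s).const_mul c2)).add ((hasDerivAt_pow 3 s).const_mul c3)).add
    ((hasDerivAt_pow 4 s).const_mul c4)).const_mul k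
  refine h.congr_deriv ?_
  push_cast
  ring

/-- Explicit formula for the partial derivative `∂H/∂x`. -/
lemma Hx_eq (a0 a1 a2 a3 a4 t x y z w : ℂ) :
    Hx a0 a1 a2 a3 a4 t x y z w = (t * (1 - t))⁻¹ *
      ((-(2 * a1 + a2 + a3) * y ^ 2
        + ((4 * a1 + 4 * a2 + 3 * a3 + a4) * t - (2 * a1 + 2 * a2 + 2 * a3 + a4)) * y
        - (1 - t) * t * a0
        + (t * z + (1 - t) * z * w - z * w ^ 2 - y * z + y * z * w + a3 * w) * y)
        + 2 * (y ^ 3 + (1 - 2 * t) * y ^ 2 + (t - 1) * t * y) * x) := by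
  have h := hasDerivAt_const_mul_quartic (t * (1 - t))⁻¹
    (a1 * (a1 + a2 + a3) * y
      + (1 / 4) * (-(z ^ 2 * w ^ 4) + 2 * a3 * z * w ^ 3
          + ((1 + t) * z ^ 2 + 2 * (2 * a1 + 2 * a2 + a3) * z - a3 ^ 2) * w ^ 2
          - 2 * (((-(2 * a1) - 2 * a2 - a3 - a4) * t + (2 * a1 + 2 * a2 + 2 * a3 + a4)) * z
              + a3 * (2 * a1 + 2 * a2 + a3)) * w
          - t * (z + 4 * a1 + 4 * a2 + 2 * a3) * z)
      - a1 * (w - 1) * z * y)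
    (-(2 * a1 + a2 + a3) * y ^ 2
      + ((4 * a1 + 4 * a2 + 3 * a3 + a4) * t - (2 * a1 + 2 * a2 + 2 * a3 + a4)) * y
      - (1 - t) * t * a0
      + (t * z + (1 - t) * z * w - z * w ^ 2 - y * z + y * z * w + a3 * w) * y)
    (y ^ 3 + (1 - 2 * t) * y ^ 2 + (t - 1) * t * y) (0) (0) x
  refine (HasDerivAt.congr_deriv (h.congr_of_eventuallyEq (Filter.Eventually.of_forall
    fun s => ?_)) ?_).deriv
  · simp only [H]
    ring
  · ring

/-- Explicit formula for the partial derivative `∂H/∂y`. -/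
lemma Hy_eq (a0 a1 a2 a3 a4 t x y z w : ℂ) :
    Hy a0 a1 a2 a3 a4 t x y z w = (t * (1 - t))⁻¹ *
      (((t - 1) * t * x ^ 2
        + ((4 * a1 + 4 * a2 + 3 * a3 + a4) * t - (2 * a1 + 2 * a2 + 2 * a3 + a4)) * x
        + a1 * (a1 + a2 + a3) + t * x * z + (1 - t) * x * z * w - x * z * w ^ 2
        - a1 * (w - 1) * z + a3 * x * w)
        + 2 * (((1 - 2 * t) * x - 2 * a1 - a2 - a3) * x - x * z + x * z * w) * y
        + 3 * (x ^ 2) * y ^ 2) := by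
  have h := hasDerivAt_const_mul_quartic (t * (1 - t))⁻¹
    (-((1 - t) * t * a0 * x)
      + (1 / 4) * (-(z ^ 2 * w ^ 4) + 2 * a3 * z * w ^ 3
          + ((1 + t) * z ^ 2 + 2 * (2 * a1 + 2 * a2 + a3) * z - a3 ^ 2) * w ^ 2
          - 2 * (((-(2 * a1) - 2 * a2 - a3 - a4) * t + (2 * a1 + 2 * a2 + 2 * a3 + a4)) * z
              + a3 * (2 * a1 + 2 * a2 + a3)) * w
          - t * (z + 4 * a1 + 4 * a2 + 2 * a3) * z))
    ((t - 1) * t * x ^ 2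
      + ((4 * a1 + 4 * a2 + 3 * a3 + a4) * t - (2 * a1 + 2 * a2 + 2 * a3 + a4)) * x
      + a1 * (a1 + a2 + a3) + t * x * z + (1 - t) * x * z * w - x * z * w ^ 2
      - a1 * (w - 1) * z + a3 * x * w)
    (((1 - 2 * t) * x - 2 * a1 - a2 - a3) * x - x * z + x * z * w) (x ^ 2) (0) y
  refine (HasDerivAt.congr_deriv (h.congr_of_eventuallyEq (Filter.Eventually.of_forall
    fun s => ?_)) ?_).deriv
  · simp only [H]
    ring
  · ring

/-- Explicit formula for the partial derivative `∂H/∂z`. -/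
lemma Hz_eq (a0 a1 a2 a3 a4 t x y z w : ℂ) :
    Hz a0 a1 a2 a3 a4 t x y z w = (t * (1 - t))⁻¹ *
      (((1 / 2) * (a3 * w ^ 3 + (2 * a1 + 2 * a2 + a3) * w ^ 2
          - ((-(2 * a1) - 2 * a2 - a3 - a4) * t + (2 * a1 + 2 * a2 + 2 * a3 + a4)) * w
          - t * (2 * a1 + 2 * a2 + a3))
        + (t * x + (1 - t) * x * w - x * w ^ 2 - x * y + x * y * w - a1 * (w - 1)) * y)
        + 2 * ((1 / 4) * (-(w ^ 4) + (1 + t) * w ^ 2 - t)) * z) := by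
  have h := hasDerivAt_const_mul_quartic (t * (1 - t))⁻¹
    (x ^ 2 * y ^ 3 + ((1 - 2 * t) * x - 2 * a1 - a2 - a3) * x * y ^ 2
      + ((t - 1) * t * x ^ 2
          + ((4 * a1 + 4 * a2 + 3 * a3 + a4) * t - (2 * a1 + 2 * a2 + 2 * a3 + a4)) * x
          + a1 * (a1 + a2 + a3)) * y
      - (1 - t) * t * a0 * x
      - (1 / 4) * (a3 ^ 2 * w ^ 2 + 2 * a3 * (2 * a1 + 2 * a2 + a3) * w)
      + a3 * x * w * y)
    ((1 / 2) * (a3 * w ^ 3 + (2 * a1 + 2 * a2 + a3) * w ^ 2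
        - ((-(2 * a1) - 2 * a2 - a3 - a4) * t + (2 * a1 + 2 * a2 + 2 * a3 + a4)) * w
        - t * (2 * a1 + 2 * a2 + a3))
      + (t * x + (1 - t) * x * w - x * w ^ 2 - x * y + x * y * w - a1 * (w - 1)) * y)
    ((1 / 4) * (-(w ^ 4) + (1 + t) * w ^ 2 - t)) (0) (0) z
  refine (HasDerivAt.congr_deriv (h.congr_of_eventuallyEq (Filter.Eventually.of_forall
    fun s => ?_)) ?_).deriv
  · simp only [H]
    ring
  · ring

/-- Explicit formula for the partial derivative `∂H/∂w`. -/
lemma Hw_eq (a0 a1 a2 a3 a4 t x y z w : ℂ) :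
    Hw a0 a1 a2 a3 a4 t x y z w = (t * (1 - t))⁻¹ *
      ((-(1 / 2) * (((-(2 * a1) - 2 * a2 - a3 - a4) * t + (2 * a1 + 2 * a2 + 2 * a3 + a4)) * z
          + a3 * (2 * a1 + 2 * a2 + a3))
        + ((1 - t) * x * z + x * y * z - a1 * z + a3 * x) * y)
        + 2 * ((1 / 4) * ((1 + t) * z ^ 2 + 2 * (2 * a1 + 2 * a2 + a3) * z - a3 ^ 2)
        - x * z * y) * w
        + 3 * ((1 / 2) * a3 * z) * w ^ 2
        + 4 * (-(1 / 4) * z ^ 2) * w ^ 3) := by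
  have h := hasDerivAt_const_mul_quartic (t * (1 - t))⁻¹
    (x ^ 2 * y ^ 3 + ((1 - 2 * t) * x - 2 * a1 - a2 - a3) * x * y ^ 2
      + ((t - 1) * t * x ^ 2
          + ((4 * a1 + 4 * a2 + 3 * a3 + a4) * t - (2 * a1 + 2 * a2 + 2 * a3 + a4)) * x
          + a1 * (a1 + a2 + a3)) * y
      - (1 - t) * t * a0 * x
      - (1 / 4) * (t * (z + 4 * a1 + 4 * a2 + 2 * a3) * z)
      + (t * x * z - x * y * z + a1 * z) * y)
    (-(1 / 2) * (((-(2 * a1) - 2 * a2 - a3 - a4) * t + (2 * a1 + 2 * a2 + 2 * a3 + a4)) * z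
        + a3 * (2 * a1 + 2 * a2 + a3))
      + ((1 - t) * x * z + x * y * z - a1 * z + a3 * x) * y)
    ((1 / 4) * ((1 + t) * z ^ 2 + 2 * (2 * a1 + 2 * a2 + a3) * z - a3 ^ 2)
      - x * z * y) ((1 / 2) * a3 * z) (-(1 / 4) * z ^ 2) w
  refine (HasDerivAt.congr_deriv (h.congr_of_eventuallyEq (Filter.Eventually.of_forall
    fun s => ?_)) ?_).deriv
  · simp only [H]
    ring
  · ring

/-- Bäcklund transformation `s₂`: if `(x, y, z, w)` solves the coupled Painlevé VI system with parameters `(α₀, α₁, α₂, α₃, α₄)` on a domain avoiding `t ∈ {0, 1}` with `y + w² - t ≠ 0`, then `(x + α₂/(y+w²-t), y, z + 2α₂w/(y+w²-t), w)` solves the system with parameters `(α₀, α₁+α₂, -α₂, α₃+2α₂, α₄)`. -/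
theorem backlund_s2
    (a0 a1 a2 a3 a4 : ℂ) (hparam : a0 + 2 * a1 + 3 * a2 + 2 * a3 + a4 = 1)
    (U : Set ℂ) (hU : ∀ t ∈ U, t ≠ 0 ∧ t ≠ 1)
    (x y z w : ℂ → ℂ)
    (hf0 : ∀ t ∈ U, y t + (w t) ^ 2 - t ≠ 0)
    (hx : ∀ t ∈ U, HasDerivAt x (Hy a0 a1 a2 a3 a4 t (x t) (y t) (z t) (w t)) t)
    (hy : ∀ t ∈ U, HasDerivAt y (-Hx a0 a1 a2 a3 a4 t (x t) (y t) (z t) (w t)) t)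
    (hz : ∀ t ∈ U, HasDerivAt z (Hw a0 a1 a2 a3 a4 t (x t) (y t) (z t) (w t)) t)
    (hw : ∀ t ∈ U, HasDerivAt w (-Hz a0 a1 a2 a3 a4 t (x t) (y t) (z t) (w t)) t) :
    (∀ t ∈ U, HasDerivAt (fun s => x s + a2 / (y s + (w s) ^ 2 - s))
        (Hy a0 (a1 + a2) (-a2) (a3 + 2 * a2) a4 t (x t + a2 / (y t + (w t) ^ 2 - t)) (y t) (z t + 2 * a2 * w t / (y t + (w t) ^ 2 - t)) (w t)) t) ∧
    (∀ t ∈ U, HasDerivAt y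
        (-Hx a0 (a1 + a2) (-a2) (a3 + 2 * a2) a4 t (x t + a2 / (y t + (w t) ^ 2 - t)) (y t) (z t + 2 * a2 * w t / (y t + (w t) ^ 2 - t)) (w t)) t) ∧
    (∀ t ∈ U, HasDerivAt (fun s => z s + 2 * a2 * w s / (y s + (w s) ^ 2 - s))
        (Hw a0 (a1 + a2) (-a2) (a3 + 2 * a2) a4 t (x t + a2 / (y t + (w t) ^ 2 - t)) (y t) (z t + 2 * a2 * w t / (y t + (w t) ^ 2 - t)) (w t)) t) ∧
    (∀ t ∈ U, HasDerivAt w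
        (-Hz a0 (a1 + a2) (-a2) (a3 + 2 * a2) a4 t (x t + a2 / (y t + (w t) ^ 2 - t)) (y t) (z t + 2 * a2 * w t / (y t + (w t) ^ 2 - t)) (w t)) t) := by
  have key : ∀ t ∈ U, HasDerivAt (fun s => y s + (w s) ^ 2 - s)
      (-Hx a0 a1 a2 a3 a4 t (x t) (y t) (z t) (w t)
        + 2 * w t * -Hz a0 a1 a2 a3 a4 t (x t) (y t) (z t) (w t) - 1) t := by
    intro t ht
    refine (((hy t ht).add ((hw t ht).pow 2)).sub (hasDerivAt_id t)).congr_deriv ?_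
    push_cast
    ring
  obtain rfl : a0 = 1 - 2 * a1 - 3 * a2 - 2 * a3 - a4 := by linear_combination hparam
  refine ⟨fun t ht => ?_, fun t ht => ?_, fun t ht => ?_, fun t ht => ?_⟩ <;>
    have hf := hf0 t ht <;>
    have h0 := (hU t ht).1 <;>
    have h1 := sub_ne_zero.2 (hU t ht).2.symm
  · refine ((hx t ht).add ((hasDerivAt_const t a2).div (key t ht) hf)).congr_deriv ?_
    simp only [Hx_eq, Hy_eq, Hz_eq]
    field_simp
    ring
  · refine (hy t ht).congr_deriv ?_
    simp only [Hx_eq]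
    field_simp
    ring
  · refine ((hz t ht).add
      (((hw t ht).const_mul (2 * a2)).div (key t ht) hf)).congr_deriv ?_
    simp only [Hx_eq, Hz_eq, Hw_eq]
    field_simp
    ring
  · refine (hw t ht).congr_deriv ?_
    simp only [Hz_eq]
    field_simp
    ring
end

section
/- Bäcklund transformation s_3: Suppose α0,α1,α2,α3,α4 ∈ ℂ satisfy α0+2α1+3α2+2α3+α4 = 1, and (x(t),y(t),z(t),w(t)) is a differentiable solution of the coupled Painlevé VI system dx/dt = ∂H/∂y, dy/dt = −∂H/∂x, dz/dt = ∂H/∂w, dw/dt = −∂H/∂z on a domain avoiding t ∈ {0,1}, with z(t) ≠ 0 throughout. Then (x, y, z, w − α3/z) is a solution of the same system with parameters (α0, α1, α2+α3, −α3, α4+α3). -/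
/-- Total derivative of a function of two variables along a curve `s ↦ (s, g s)`. -/
theorem hasDerivAt_along_graph {f : ℂ → ℂ → ℂ} {g : ℂ → ℂ} {z g' : ℂ}
    (hf : DifferentiableAt ℂ (fun p : ℂ × ℂ => f p.1 p.2) (z, g z)) (hg : HasDerivAt g g' z) :
    HasDerivAt (fun s => f s (g s))
      (deriv (fun s => f s (g z)) z + deriv (fun s => f z s) (g z) * g') z := by
  have hF := hf.hasFDerivAt
  have h₁ := (hF.comp_hasDerivAt z ((hasDerivAt_id z).prodMk (hasDerivAt_const z (g z)))).deriv
  have h₂ := (hF.comp_hasDerivAt (g z)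
    ((hasDerivAt_const (g z) z).prodMk (hasDerivAt_id (g z)))).deriv
  have h₃ := hF.comp_hasDerivAt z ((hasDerivAt_id z).prodMk hg)
  simp only [Function.comp_def, id_eq] at h₁ h₂ h₃
  rw [h₁, h₂]
  refine h₃.congr_deriv ?_
  rw [mul_comm, ← smul_eq_mul, ← map_smul, ← map_add]
  simp

/-- The shift `w ↦ w - α₃ / z` changes the Hamiltonian only by a function of `t`. -/
theorem H_sub_div (a0 a1 a2 a3 a4 t x y z w : ℂ) (hz : z ≠ 0) :
    H a0 a1 (a2 + a3) (-a3) (a4 + a3) t x y z (w - a3 / z) =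
      H a0 a1 a2 a3 a4 t x y z w
        + (t * (1 - t))⁻¹ * ((1 - t) * a3 * (4 * a1 + 4 * a2 + 3 * a3 + 2 * a4) / 4) := by
  unfold H
  generalize (t * (1 - t))⁻¹ = c
  field_simp
  ring

theorem differentiable_H_zw (a0 a1 a2 a3 a4 t x y : ℂ) :
    Differentiable ℂ (fun p : ℂ × ℂ => H a0 a1 a2 a3 a4 t x y p.1 p.2) := by
  unfold H
  fun_prop

theorem Hx_sub_div (a0 a1 a2 a3 a4 t x y z w : ℂ) (hz : z ≠ 0) :
    Hx a0 a1 (a2 + a3) (-a3) (a4 + a3) t x y z (w - a3 / z) = Hx a0 a1 a2 a3 a4 t x y z w := by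
  simp only [Hx, H_sub_div _ _ _ _ _ _ _ _ _ _ hz, deriv_add_const]

theorem Hy_sub_div (a0 a1 a2 a3 a4 t x y z w : ℂ) (hz : z ≠ 0) :
    Hy a0 a1 (a2 + a3) (-a3) (a4 + a3) t x y z (w - a3 / z) = Hy a0 a1 a2 a3 a4 t x y z w := by
  simp only [Hy, H_sub_div _ _ _ _ _ _ _ _ _ _ hz, deriv_add_const]

theorem Hw_sub_div (a0 a1 a2 a3 a4 t x y z w : ℂ) (hz : z ≠ 0) :
    Hw a0 a1 (a2 + a3) (-a3) (a4 + a3) t x y z (w - a3 / z) = Hw a0 a1 a2 a3 a4 t x y z w := by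
  unfold Hw
  rw [← deriv_comp_sub_const]
  simp only [H_sub_div _ _ _ _ _ _ _ _ _ _ hz, deriv_add_const]

theorem Hz_sub_div (a0 a1 a2 a3 a4 t x y z w : ℂ) (hz : z ≠ 0) :
    Hz a0 a1 (a2 + a3) (-a3) (a4 + a3) t x y z (w - a3 / z) =
      Hz a0 a1 a2 a3 a4 t x y z w - a3 / z ^ 2 * Hw a0 a1 a2 a3 a4 t x y z w := by
  have hg : HasDerivAt (fun s => w - a3 / z + a3 / s) (-(a3 / z ^ 2)) z := by
    simp only [div_eq_mul_inv]
    refine (((hasDerivAt_inv hz).const_mul a3).const_add _).congr_deriv ?_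
    ring
  have h := (hasDerivAt_along_graph
    (differentiable_H_zw a0 a1 a2 a3 a4 t x y).differentiableAt hg).add_const
      ((t * (1 - t))⁻¹ * ((1 - t) * a3 * (4 * a1 + 4 * a2 + 3 * a3 + 2 * a4) / 4))
  have heq : (fun s => H a0 a1 (a2 + a3) (-a3) (a4 + a3) t x y s (w - a3 / z)) =ᶠ[nhds z]
      fun s => H a0 a1 a2 a3 a4 t x y s (w - a3 / z + a3 / s)
        + (t * (1 - t))⁻¹ * ((1 - t) * a3 * (4 * a1 + 4 * a2 + 3 * a3 + 2 * a4) / 4) := by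
    filter_upwards [isOpen_ne.mem_nhds hz] with s hs
    rw [← H_sub_div _ _ _ _ _ _ _ _ _ _ hs, add_sub_cancel_right]
  unfold Hz Hw
  rw [heq.deriv_eq, h.deriv]
  simp only [sub_add_cancel]
  ring

/-- Bäcklund transformation `s₃`: if `(x, y, z, w)` solves the coupled Painlevé VI system with parameters `(α₀, α₁, α₂, α₃, α₄)` on a domain avoiding `t ∈ {0, 1}` with `z ≠ 0`, then `(x, y, z, w - α₃/z)` solves the system with parameters `(α₀, α₁, α₂+α₃, -α₃, α₄+α₃)`. -/
theorem backlund_s3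
    (a0 a1 a2 a3 a4 : ℂ) (hparam : a0 + 2 * a1 + 3 * a2 + 2 * a3 + a4 = 1)
    (U : Set ℂ) (hU : ∀ t ∈ U, t ≠ 0 ∧ t ≠ 1)
    (x y z w : ℂ → ℂ)
    (hz0 : ∀ t ∈ U, z t ≠ 0)
    (hx : ∀ t ∈ U, HasDerivAt x (Hy a0 a1 a2 a3 a4 t (x t) (y t) (z t) (w t)) t)
    (hy : ∀ t ∈ U, HasDerivAt y (-Hx a0 a1 a2 a3 a4 t (x t) (y t) (z t) (w t)) t)
    (hz : ∀ t ∈ U, HasDerivAt z (Hw a0 a1 a2 a3 a4 t (x t) (y t) (z t) (w t)) t)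
    (hw : ∀ t ∈ U, HasDerivAt w (-Hz a0 a1 a2 a3 a4 t (x t) (y t) (z t) (w t)) t) :
    (∀ t ∈ U, HasDerivAt x
        (Hy a0 a1 (a2 + a3) (-a3) (a4 + a3) t (x t) (y t) (z t) (w t - a3 / z t)) t) ∧
    (∀ t ∈ U, HasDerivAt y
        (-Hx a0 a1 (a2 + a3) (-a3) (a4 + a3) t (x t) (y t) (z t) (w t - a3 / z t)) t) ∧
    (∀ t ∈ U, HasDerivAt z
        (Hw a0 a1 (a2 + a3) (-a3) (a4 + a3) t (x t) (y t) (z t) (w t - a3 / z t)) t) ∧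
    (∀ t ∈ U, HasDerivAt (fun s => w s - a3 / z s)
        (-Hz a0 a1 (a2 + a3) (-a3) (a4 + a3) t (x t) (y t) (z t) (w t - a3 / z t)) t) := by
  refine ⟨fun t ht => ?_, fun t ht => ?_, fun t ht => ?_, fun t ht => ?_⟩
  · rw [Hy_sub_div _ _ _ _ _ _ _ _ _ _ (hz0 t ht)]
    exact hx t ht
  · rw [Hx_sub_div _ _ _ _ _ _ _ _ _ _ (hz0 t ht)]
    exact hy t ht
  · rw [Hw_sub_div _ _ _ _ _ _ _ _ _ _ (hz0 t ht)]
    exact hz t ht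
  · rw [Hz_sub_div _ _ _ _ _ _ _ _ _ _ (hz0 t ht)]
    simp only [div_eq_mul_inv]
    refine ((hw t ht).sub (((hz t ht).inv (hz0 t ht)).const_mul a3)).congr_deriv ?_
    ring
end

section
/- The Bäcklund transformation s_2 is symplectic: for fixed t ∈ ℂ and α2 ∈ ℂ, the map (x,y,z,w) ↦ (X,Y,Z,W) = (x + α2/(y+w²−t), y, z + 2α2 w/(y+w²−t), w), defined on the open set where y+w²−t ≠ 0, preserves the canonical symplectic form, i.e., its Jacobian matrix J at every point satisfies JᵀΩJ = Ω, where Ω is the standard symplectic matrix corresponding to the 2-form dx∧dy + dz∧dw (equivalently, the canonical Poisson brackets {Y,X} = 1, {W,Z} = 1, {X,Z} = {X,W} = {Y,Z} = {Y,W} = {X,Y}... all other brackets vanish). -/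
open Matrix

noncomputable section

/-- The standard symplectic matrix `Ω` on `ℂ⁴` corresponding to the canonical 2-form
`dx∧dy + dz∧dw` in the coordinates `(x, y, z, w)`. -/
def Omega : Matrix (Fin 4) (Fin 4) ℂ :=
  !![0, 1, 0, 0; -1, 0, 0, 0; 0, 0, 0, 1; 0, 0, -1, 0]

/-- The Jacobian matrix of a map `F : ℂ⁴ → ℂ⁴` at a point `p`, whose `(i, j)` entry is the
partial derivative of the `i`-th component of `F` with respect to the `j`-th coordinate. -/
def jacobian (F : (Fin 4 → ℂ) → Fin 4 → ℂ) (p : Fin 4 → ℂ) : Matrix (Fin 4) (Fin 4) ℂ :=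
  Matrix.of fun i j => deriv (fun s => F (Function.update p j s) i) (p j)

/-- The Bäcklund transformation `s₂` of the coupled Painlevé VI system of type `E₆⁽²⁾` as a
map of `(x, y, z, w) ∈ ℂ⁴` (coordinates `p 0 = x`, `p 1 = y`, `p 2 = z`, `p 3 = w`), for fixed
time `t` and parameter `α₂`. -/
def s2map (t a2 : ℂ) (p : Fin 4 → ℂ) : Fin 4 → ℂ :=
  ![p 0 + a2 / (p 1 + (p 3) ^ 2 - t), p 1,
    p 2 + 2 * a2 * (p 3) / (p 1 + (p 3) ^ 2 - t), p 3]

end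

/-- The Jacobian matrix of `s₂`: it is the identity plus a symmetric block depending on `y, w`. -/
theorem jacobian_s2map (t a2 : ℂ) (p : Fin 4 → ℂ) (h : p 1 + (p 3) ^ 2 - t ≠ 0) :
    jacobian (s2map t a2) p =
      !![1, -a2 / (p 1 + (p 3) ^ 2 - t) ^ 2, 0, -(2 * a2 * p 3) / (p 1 + (p 3) ^ 2 - t) ^ 2;
        0, 1, 0, 0;
        0, -(2 * a2 * p 3) / (p 1 + (p 3) ^ 2 - t) ^ 2, 1,
          (2 * a2 * (p 1 + (p 3) ^ 2 - t) - 2 * a2 * p 3 * (2 * p 3)) /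
            (p 1 + (p 3) ^ 2 - t) ^ 2;
        0, 0, 0, 1] := by
  have hy : HasDerivAt (fun s : ℂ => s + (p 3) ^ 2 - t) 1 (p 1) :=
    ((hasDerivAt_id (p 1)).add_const _).sub_const _
  have hw : HasDerivAt (fun s : ℂ => p 1 + s ^ 2 - t) (2 * p 3) (p 3) := by
    simpa using ((hasDerivAt_pow 2 (p 3)).const_add (p 1)).sub_const t
  have hXy : deriv (fun s : ℂ => a2 / (s + (p 3) ^ 2 - t)) (p 1) =
      -a2 / (p 1 + (p 3) ^ 2 - t) ^ 2 := by
    simpa using ((hasDerivAt_const (p 1) a2).fun_div hy h).deriv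
  have hZy : deriv (fun s : ℂ => 2 * a2 * p 3 / (s + (p 3) ^ 2 - t)) (p 1) =
      -(2 * a2 * p 3) / (p 1 + (p 3) ^ 2 - t) ^ 2 := by
    simpa using ((hasDerivAt_const (p 1) (2 * a2 * p 3)).fun_div hy h).deriv
  have hXw : deriv (fun s : ℂ => a2 / (p 1 + s ^ 2 - t)) (p 3) =
      -(2 * a2 * p 3) / (p 1 + (p 3) ^ 2 - t) ^ 2 := by
    rw [((hasDerivAt_const (p 3) a2).fun_div hw h).deriv]
    ring
  have hZw : deriv (fun s : ℂ => 2 * a2 * s / (p 1 + s ^ 2 - t)) (p 3) =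
      (2 * a2 * (p 1 + (p 3) ^ 2 - t) - 2 * a2 * p 3 * (2 * p 3)) /
        (p 1 + (p 3) ^ 2 - t) ^ 2 := by
    simpa using (((hasDerivAt_id (p 3)).const_mul (2 * a2)).fun_div hw h).deriv
  ext i j
  fin_cases i <;> fin_cases j <;>
    simp [jacobian, s2map, Function.update_apply, hXy, hZy, hXw, hZw]

/-- The Bäcklund transformation `s₂` is symplectic: for fixed `t ∈ ℂ` and `α₂ ∈ ℂ`, the map
`(x, y, z, w) ↦ (x + α₂/(y+w²-t), y, z + 2α₂w/(y+w²-t), w)`, defined where `y + w² - t ≠ 0`,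
preserves the canonical symplectic form `dx∧dy + dz∧dw`: its Jacobian matrix `J` at every
point satisfies `Jᵀ Ω J = Ω`. -/
theorem s2_symplectic (t a2 : ℂ) (p : Fin 4 → ℂ) (h : p 1 + (p 3) ^ 2 - t ≠ 0) :
    (jacobian (s2map t a2) p)ᵀ * Omega * jacobian (s2map t a2) p = Omega := by
  rw [jacobian_s2map t a2 p h]
  ext i j
  fin_cases i <;> fin_cases j <;>
    simp [Omega, Matrix.mul_apply, Fin.sum_univ_four]
end

section
/- Invariant divisor f_4 = w−1: If α4 = 0, then for all t ∉ {0,1} and all (x,y,z) ∈ ℂ³, the partial derivative ∂H/∂z of the Hamiltonian H evaluated at w = 1 equals 0; equivalently, w−1 divides ∂H/∂z as a polynomial in x,y,z,w when α4 = 0. Hence the locus {w = 1} is invariant under the flow of the coupled Painlevé VI system when α4 = 0. -/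
/-- On the locus `w = 1` with `α₄ = 0`, the Hamiltonian does not depend on `z`. -/
lemma H_w_one_eq_H_z_zero (a0 a1 a2 a3 t x y z : ℂ) :
    H a0 a1 a2 a3 0 t x y z 1 = H a0 a1 a2 a3 0 t x y 0 1 := by
  unfold H
  congr 1
  ring

/-- Invariant divisor `f₄ = w - 1`: if `α₄ = 0`, the partial derivative `∂H/∂z` vanishes on
the locus `w = 1`, so this locus is invariant under the flow of the coupled Painlevé VI
system. -/
theorem invariant_divisor_f4 (a0 a1 a2 a3 a4 t x y z : ℂ) (ht0 : t ≠ 0) (ht1 : t ≠ 1)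
    (ha4 : a4 = 0) :
    Hz a0 a1 a2 a3 a4 t x y z 1 = 0 := by
  subst ha4
  simp only [Hz, H_w_one_eq_H_z_zero, deriv_const]
end

section
/- The first principal part K_1 of the Hamiltonian H is equivalent to the sixth Painlevé equation: if (x(t), y(t)) is a differentiable solution of the Hamiltonian system dx/dt = ∂K_1/∂y, dy/dt = −∂K_1/∂x on a domain avoiding t ∈ {0,1}, then (X,Y) := (t − y, x) is a solution of the Painlevé VI Hamiltonian system dX/dt = ∂H_VI/∂Y, dY/dt = −∂H_VI/∂X with Hamiltonian H_VI(X,Y,t; α0, α2+α3, α1, α2+α3+α4, α2). -/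
noncomputable section

/-- The first principal part `K₁` of the Hamiltonian `H` of the coupled Painlevé VI system of
type `E₆⁽²⁾` (obtained from `H` by setting `z = w = 0`), defined by `t(1-t)K₁ = ...`. -/
def K1 (a0 a1 a2 a3 a4 t x y : ℂ) : ℂ :=
  (t * (1 - t))⁻¹ *
    (x ^ 2 * y ^ 3 + ((1 - 2 * t) * x - 2 * a1 - a2 - a3) * x * y ^ 2
      + ((t - 1) * t * x ^ 2
          + ((4 * a1 + 4 * a2 + 3 * a3 + a4) * t - (2 * a1 + 2 * a2 + 2 * a3 + a4)) * x
          + a1 * (a1 + a2 + a3)) * y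
      - (1 - t) * t * a0 * x)

/-- Partial derivative `∂K₁/∂x`. -/
def K1x (a0 a1 a2 a3 a4 t x y : ℂ) : ℂ :=
  deriv (fun s => K1 a0 a1 a2 a3 a4 t s y) x

/-- Partial derivative `∂K₁/∂y`. -/
def K1y (a0 a1 a2 a3 a4 t x y : ℂ) : ℂ :=
  deriv (fun s => K1 a0 a1 a2 a3 a4 t x s) y

/-- The Painlevé VI Hamiltonian `H_VI(x, y, t; β₀, β₁, β₂, β₃, β₄)`. -/
def HVI (b0 b1 b2 b3 b4 t x y : ℂ) : ℂ :=
  (t * (t - 1))⁻¹ *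
    (y ^ 2 * (x - t) * (x - 1) * x
      - ((b0 - 1) * (x - 1) * x + b3 * (x - t) * x + b4 * (x - t) * (x - 1)) * y
      + b2 * (b1 + b2) * x)

/-- Partial derivative `∂H_VI/∂x`. -/
def HVIx (b0 b1 b2 b3 b4 t x y : ℂ) : ℂ :=
  deriv (fun s => HVI b0 b1 b2 b3 b4 t s y) x

/-- Partial derivative `∂H_VI/∂y`. -/
def HVIy (b0 b1 b2 b3 b4 t x y : ℂ) : ℂ :=
  deriv (fun s => HVI b0 b1 b2 b3 b4 t x s) y

end

/-- In the coordinates `(X, Y) = (t - y, x)`, the Painlevé VI Hamiltonian equals `K₁ + x` up to a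
function of `t` alone. -/
theorem HVI_eq_K1_add (a0 a1 a2 a3 a4 : ℂ) (hparam : a0 + 2 * a1 + 3 * a2 + 2 * a3 + a4 = 1)
    {t : ℂ} (ht0 : t ≠ 0) (ht1 : t ≠ 1) (x y : ℂ) :
    HVI a0 (a2 + a3) a1 (a2 + a3 + a4) a2 t (t - y) x =
      K1 a0 a1 a2 a3 a4 t x y + x + a1 * (a1 + a2 + a3) / (t - 1) := by
  obtain rfl : a0 = 1 - 2 * a1 - 3 * a2 - 2 * a3 - a4 := by linear_combination hparam
  have h1 : t - 1 ≠ 0 := sub_ne_zero.mpr ht1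
  have h2 : (t * (1 - t))⁻¹ = -(t * (t - 1))⁻¹ := by rw [← inv_neg]; ring_nf
  unfold HVI K1
  rw [h2]
  field_simp
  ring

theorem differentiable_K1_left (a0 a1 a2 a3 a4 t y : ℂ) :
    Differentiable ℂ (fun s => K1 a0 a1 a2 a3 a4 t s y) := by
  unfold K1
  fun_prop

theorem HVIy_eq_K1x_add_one (a0 a1 a2 a3 a4 : ℂ)
    (hparam : a0 + 2 * a1 + 3 * a2 + 2 * a3 + a4 = 1)
    {t : ℂ} (ht0 : t ≠ 0) (ht1 : t ≠ 1) (x y : ℂ) :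
    HVIy a0 (a2 + a3) a1 (a2 + a3 + a4) a2 t (t - y) x = K1x a0 a1 a2 a3 a4 t x y + 1 := by
  unfold HVIy K1x
  simp only [HVI_eq_K1_add a0 a1 a2 a3 a4 hparam ht0 ht1, deriv_add_const]
  exact ((differentiable_K1_left a0 a1 a2 a3 a4 t y x).hasDerivAt.add (hasDerivAt_id x)).deriv

theorem HVIx_eq_neg_K1y (a0 a1 a2 a3 a4 : ℂ)
    (hparam : a0 + 2 * a1 + 3 * a2 + 2 * a3 + a4 = 1)
    {t : ℂ} (ht0 : t ≠ 0) (ht1 : t ≠ 1) (x y : ℂ) :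
    HVIx a0 (a2 + a3) a1 (a2 + a3 + a4) a2 t (t - y) x = -K1y a0 a1 a2 a3 a4 t x y := by
  have h : (fun s => HVI a0 (a2 + a3) a1 (a2 + a3 + a4) a2 t s x) = fun s =>
      K1 a0 a1 a2 a3 a4 t x (t - s) + x + a1 * (a1 + a2 + a3) / (t - 1) := by
    funext s
    rw [← HVI_eq_K1_add a0 a1 a2 a3 a4 hparam ht0 ht1, sub_sub_cancel]
  unfold HVIx K1y
  rw [h, deriv_add_const, deriv_add_const,
    deriv_comp_const_sub (f := fun s => K1 a0 a1 a2 a3 a4 t x s), sub_sub_cancel]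

/-- The first principal part `K₁` of the Hamiltonian `H` is equivalent to the sixth Painlevé
equation: if `(x(t), y(t))` solves the Hamiltonian system `dx/dt = ∂K₁/∂y`,
`dy/dt = -∂K₁/∂x` on a domain avoiding `t ∈ {0, 1}`, then `(X, Y) := (t - y, x)` solves the
Painlevé VI Hamiltonian system with Hamiltonian
`H_VI(X, Y, t; α₀, α₂+α₃, α₁, α₂+α₃+α₄, α₂)`. -/
theorem K1_equivalent_to_PVI
    (a0 a1 a2 a3 a4 : ℂ) (hparam : a0 + 2 * a1 + 3 * a2 + 2 * a3 + a4 = 1)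
    (U : Set ℂ) (hU : ∀ t ∈ U, t ≠ 0 ∧ t ≠ 1)
    (x y : ℂ → ℂ)
    (hx : ∀ t ∈ U, HasDerivAt x (K1y a0 a1 a2 a3 a4 t (x t) (y t)) t)
    (hy : ∀ t ∈ U, HasDerivAt y (-K1x a0 a1 a2 a3 a4 t (x t) (y t)) t) :
    (∀ t ∈ U, HasDerivAt (fun s => s - y s)
      (HVIy a0 (a2 + a3) a1 (a2 + a3 + a4) a2 t (t - y t) (x t)) t) ∧
    (∀ t ∈ U, HasDerivAt x
      (-HVIx a0 (a2 + a3) a1 (a2 + a3 + a4) a2 t (t - y t) (x t)) t) := by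
  refine ⟨fun t ht => ?_, fun t ht => ?_⟩ <;> obtain ⟨ht0, ht1⟩ := hU t ht
  · rw [HVIy_eq_K1x_add_one a0 a1 a2 a3 a4 hparam ht0 ht1]
    exact ((hasDerivAt_id t).sub (hy t ht)).congr_deriv (by ring)
  · rw [HVIx_eq_neg_K1y a0 a1 a2 a3 a4 hparam ht0 ht1, neg_neg]
    exact hx t ht
end

section
/- Each of the coordinate changes r_0, r_1, r_2, r_3, r_4 is symplectic with respect to the canonical 2-form dx∧dy + dz∧dw: for fixed t, at every point of its domain the Jacobian matrix J of the map satisfies JᵀΩJ = Ω, where Ω is the standard symplectic matrix of the form dx∧dy + dz∧dw. In particular for the nontrivial case r_2, the map (x,y,z,w) ↦ (1/x, −((y+w²−t)x+α2)x, z−2xw, w) preserves dx∧dy + dz∧dw on {x ≠ 0}. -/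
open Matrix

noncomputable section

/-- The coordinate change `r₀ : (x, y, z, w) ↦ (1/x, -(yx+α₀)x, z, w)`. -/
def r0map (a0 : ℂ) (p : Fin 4 → ℂ) : Fin 4 → ℂ :=
  ![(p 0)⁻¹, -(p 1 * p 0 + a0) * p 0, p 2, p 3]

/-- The coordinate change `r₁ : (x, y, z, w) ↦ (-(xy-α₁)y, 1/y, z, w)`. -/
def r1map (a1 : ℂ) (p : Fin 4 → ℂ) : Fin 4 → ℂ :=
  ![-(p 0 * p 1 - a1) * p 1, (p 1)⁻¹, p 2, p 3]

/-- The coordinate change `r₂ : (x, y, z, w) ↦ (1/x, -((y+w²-t)x+α₂)x, z-2xw, w)`. -/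
def r2map (t a2 : ℂ) (p : Fin 4 → ℂ) : Fin 4 → ℂ :=
  ![(p 0)⁻¹, -((p 1 + (p 3) ^ 2 - t) * p 0 + a2) * p 0, p 2 - 2 * p 0 * p 3, p 3]

/-- The coordinate change `r₃ : (x, y, z, w) ↦ (x, y, -(zw-α₃)w, 1/w)`. -/
def r3map (a3 : ℂ) (p : Fin 4 → ℂ) : Fin 4 → ℂ :=
  ![p 0, p 1, -(p 2 * p 3 - a3) * p 3, (p 3)⁻¹]

/-- The coordinate change `r₄ : (x, y, z, w) ↦ (x, y, 1/z, -((w-1)z+α₄)z)`. -/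
def r4map (a4 : ℂ) (p : Fin 4 → ℂ) : Fin 4 → ℂ :=
  ![p 0, p 1, (p 2)⁻¹, -((p 3 - 1) * p 2 + a4) * p 2]

end

theorem jacobian_r0map (a0 : ℂ) (p : Fin 4 → ℂ) :
    jacobian (r0map a0) p =
      !![-(p 0 ^ 2)⁻¹, 0, 0, 0;
        -(2 * p 0 * p 1 + a0), -p 0 ^ 2, 0, 0;
        0, 0, 1, 0;
        0, 0, 0, 1] := by
  ext i j
  fin_cases i <;> fin_cases j <;>
    simp (disch := first | decide | fun_prop) [jacobian, r0map, deriv_fun_add, deriv_fun_mul] <;>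
    ring

theorem jacobian_r1map (a1 : ℂ) (p : Fin 4 → ℂ) :
    jacobian (r1map a1) p =
      !![-p 1 ^ 2, -(2 * p 0 * p 1 - a1), 0, 0;
        0, -(p 1 ^ 2)⁻¹, 0, 0;
        0, 0, 1, 0;
        0, 0, 0, 1] := by
  ext i j
  fin_cases i <;> fin_cases j <;>
    simp (disch := first | decide | fun_prop) [jacobian, r1map, deriv_fun_sub,
      deriv_fun_mul] <;> ring

theorem jacobian_r2map (t a2 : ℂ) (p : Fin 4 → ℂ) :
    jacobian (r2map t a2) p =
      !![-(p 0 ^ 2)⁻¹, 0, 0, 0;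
        -(2 * p 0 * (p 1 + p 3 ^ 2 - t) + a2), -p 0 ^ 2, 0, -(2 * p 0 ^ 2 * p 3);
        -(2 * p 3), 0, 1, -(2 * p 0);
        0, 0, 0, 1] := by
  ext i j
  fin_cases i <;> fin_cases j <;>
    simp (disch := first | decide | fun_prop) [jacobian, r2map, deriv_fun_add, deriv_fun_sub,
      deriv_fun_mul] <;> ring

theorem jacobian_r3map (a3 : ℂ) (p : Fin 4 → ℂ) :
    jacobian (r3map a3) p =
      !![1, 0, 0, 0;
        0, 1, 0, 0;
        0, 0, -p 3 ^ 2, -(2 * p 2 * p 3 - a3);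
        0, 0, 0, -(p 3 ^ 2)⁻¹] := by
  ext i j
  fin_cases i <;> fin_cases j <;>
    simp (disch := first | decide | fun_prop) [jacobian, r3map, deriv_fun_sub,
      deriv_fun_mul] <;> ring

theorem jacobian_r4map (a4 : ℂ) (p : Fin 4 → ℂ) :
    jacobian (r4map a4) p =
      !![1, 0, 0, 0;
        0, 1, 0, 0;
        0, 0, -(p 2 ^ 2)⁻¹, 0;
        0, 0, -(2 * p 2 * (p 3 - 1) + a4), -p 2 ^ 2] := by
  ext i j
  fin_cases i <;> fin_cases j <;>
    simp (disch := first | decide | fun_prop) [jacobian, r4map, deriv_fun_add, deriv_fun_sub,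
      deriv_fun_mul] <;> ring

/-- Each of the coordinate changes `r₀, r₁, r₂, r₃, r₄` of the holomorphy condition for the
coupled Painlevé VI system of type `E₆⁽²⁾` is symplectic with respect to the canonical 2-form
`dx∧dy + dz∧dw`: for fixed `t` and parameters, at every point of its domain the Jacobian
matrix `J` satisfies `Jᵀ Ω J = Ω`, where `Ω` is the standard symplectic matrix. -/
theorem r_maps_symplectic (t a0 a1 a2 a3 a4 : ℂ) :
    (∀ p : Fin 4 → ℂ, p 0 ≠ 0 →
      (jacobian (r0map a0) p)ᵀ * Omega * jacobian (r0map a0) p = Omega) ∧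
    (∀ p : Fin 4 → ℂ, p 1 ≠ 0 →
      (jacobian (r1map a1) p)ᵀ * Omega * jacobian (r1map a1) p = Omega) ∧
    (∀ p : Fin 4 → ℂ, p 0 ≠ 0 →
      (jacobian (r2map t a2) p)ᵀ * Omega * jacobian (r2map t a2) p = Omega) ∧
    (∀ p : Fin 4 → ℂ, p 3 ≠ 0 →
      (jacobian (r3map a3) p)ᵀ * Omega * jacobian (r3map a3) p = Omega) ∧
    (∀ p : Fin 4 → ℂ, p 2 ≠ 0 →
      (jacobian (r4map a4) p)ᵀ * Omega * jacobian (r4map a4) p = Omega) := by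
  refine ⟨fun p hp => ?_, fun p hp => ?_, fun p hp => ?_, fun p hp => ?_, fun p hp => ?_⟩
  on_goal 1 => rw [jacobian_r0map]
  on_goal 2 => rw [jacobian_r1map]
  on_goal 3 => rw [jacobian_r2map]
  on_goal 4 => rw [jacobian_r3map]
  on_goal 5 => rw [jacobian_r4map]
  all_goals
    ext i j
    fin_cases i <;> fin_cases j <;>
      simp [Omega, Matrix.mul_apply, Fin.sum_univ_four] <;> field_simp <;> ring
end
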